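/- (Case λ = 0, μ ≠ 0: nonexistence.) There exist no real constant μ ≠ 0 and smooth p, q, φ as in the setup such that on (a,b): sin φ + 1/sin φ + (φ'' cos φ)/(2φ'²) − (H cos²φ)/(φ' sin φ) = 0 and −(3/2)cos φ + (φ'' sin φ)/(2φ'²) − (sin φ cos φ)/(2 p φ') = μ q. -/

import Mathlib

open Real Set

/-- Functions agreeing on an open interval have the same derivative at each of its points. -/
lemma HasDerivAt.eq_of_eqOn_Ioo {a b u F' G' : ℝ} {F G : ℝ → ℝ} (hu : u ∈ Ioo a b)
    (h : ∀ x ∈ Ioo a b, F x = G x) (hF : HasDerivAt F F' u) (hG : HasDerivAt G G' u) :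
    F' = G' :=
  hF.unique (hG.congr_of_eventuallyEq
    (Filter.eventually_of_mem (isOpen_Ioo.mem_nhds hu) h))

/-- Case λ = 0, μ ≠ 0: there exist no real constant `μ ≠ 0` and smooth `p, q, φ` as in
the setup (surface of revolution, unit-speed profile, nonvanishing Gauss curvature) with
`Δ^II(p cos v)/cos v = 0` and `Δ^II(q) = μ q` on `(a,b)`. -/
theorem case_IV_nonexistence
    {a b : ℝ} (hab : a < b) :
    ¬ ∃ (mu : ℝ) (p q φ H : ℝ → ℝ),
      mu ≠ 0 ∧ ContDiff ℝ (⊤ : ℕ∞) p ∧ ContDiff ℝ (⊤ : ℕ∞) q ∧ ContDiff ℝ (⊤ : ℕ∞) φ ∧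
      (∀ u ∈ Ioo a b, 0 < p u) ∧
      (∀ u ∈ Ioo a b, deriv p u = Real.cos (φ u)) ∧
      (∀ u ∈ Ioo a b, deriv q u = Real.sin (φ u)) ∧
      (∀ u ∈ Ioo a b, deriv φ u ≠ 0) ∧
      (∀ u ∈ Ioo a b, Real.sin (φ u) ≠ 0) ∧
      (∀ u ∈ Ioo a b, 2 * H u = deriv φ u + Real.sin (φ u) / p u) ∧
      (∀ u ∈ Ioo a b, Real.sin (φ u) + 1 / Real.sin (φ u)
            + deriv (deriv φ) u * Real.cos (φ u) / (2 * deriv φ u ^ 2)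
            - H u * Real.cos (φ u) ^ 2 / (deriv φ u * Real.sin (φ u)) = 0) ∧
      (∀ u ∈ Ioo a b, -(3 / 2) * Real.cos (φ u)
            + deriv (deriv φ) u * Real.sin (φ u) / (2 * deriv φ u ^ 2)
            - Real.sin (φ u) * Real.cos (φ u) / (2 * p u * deriv φ u) = mu * q u) := by
  rintro ⟨mu, p, q, φ, H, hmu, hp, hq, hφ, hp0, hdp, hdq, hf, hs, hH, h1, h2⟩
  have dp : ∀ u ∈ Ioo a b, HasDerivAt p (cos (φ u)) u := fun u hu =>
    hdp u hu ▸ (hp.differentiable (by simp) u).hasDerivAt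
  have dq : ∀ u ∈ Ioo a b, HasDerivAt q (sin (φ u)) u := fun u hu =>
    hdq u hu ▸ (hq.differentiable (by simp) u).hasDerivAt
  have dφ : ∀ u, HasDerivAt φ (deriv φ u) u := fun u =>
    (hφ.differentiable (by simp) u).hasDerivAt
  have ddφ : ∀ u, HasDerivAt (deriv φ) (deriv (deriv φ) u) u := fun u =>
    (((contDiff_infty_iff_deriv.1 hφ).2).differentiable (by simp) u).hasDerivAt
  have key : ∀ u ∈ Ioo a b, mu * (q u * cos (φ u)) = -2 := by
    intro u hu
    have hpu := (hp0 u hu).ne'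
    have hfu := hf u hu
    have hsu := hs u hu
    have e1 := h1 u hu
    have e2 := h2 u hu
    have hHu : H u = (deriv φ u + sin (φ u) / p u) / 2 := by linarith [hH u hu]
    rw [hHu] at e1
    have hsc := sin_sq_add_cos_sq (φ u)
    have : sin (φ u) * (sin (φ u) + 1 / sin (φ u)
        + deriv (deriv φ) u * cos (φ u) / (2 * deriv φ u ^ 2)
        - (deriv φ u + sin (φ u) / p u) / 2 * cos (φ u) ^ 2 / (deriv φ u * sin (φ u)))
        - cos (φ u) * (-(3 / 2) * cos (φ u)
        + deriv (deriv φ) u * sin (φ u) / (2 * deriv φ u ^ 2)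
        - sin (φ u) * cos (φ u) / (2 * p u * deriv φ u))
        = sin (φ u) ^ 2 + cos (φ u) ^ 2 + 1 := by
      field_simp
      ring
    rw [e1, e2] at this
    linarith
  have hc : ∀ u ∈ Ioo a b, cos (φ u) ≠ 0 := by
    intro u hu h
    have := key u hu
    rw [h] at this
    norm_num at this
  have hfc : ∀ u ∈ Ioo a b, deriv φ u = -(mu / 2) * cos (φ u) ^ 2 := by
    intro u hu
    have e := HasDerivAt.eq_of_eqOn_Ioo hu key
      (((dq u hu).mul (dφ u).cos).const_mul mu) (hasDerivAt_const u (-2 : ℝ))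
    have e' : cos (φ u) = q u * deriv φ u := by
      apply mul_left_cancel₀ (mul_ne_zero hmu (hs u hu))
      linear_combination e
    linear_combination (mu / 2 * cos (φ u)) * e' + deriv φ u / 2 * key u hu
  have hg : ∀ u ∈ Ioo a b, deriv (deriv φ) u = mu * cos (φ u) * sin (φ u) * deriv φ u := by
    intro u hu
    have e := HasDerivAt.eq_of_eqOn_Ioo hu hfc (ddφ u)
      (((dφ u).cos.pow 2).const_mul (-(mu / 2)))
    rw [e]
    norm_num
    ring
  have hps : ∀ u ∈ Ioo a b, mu * (p u * (1 + sin (φ u) ^ 2)) = -2 * sin (φ u) := by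
    intro u hu
    have hpu := (hp0 u hu).ne'
    have hcu := hc u hu
    have e2 := h2 u hu
    have hsc := sin_sq_add_cos_sq (φ u)
    rw [hg u hu, hfc u hu] at e2
    have hq' : mu * q u = -2 / cos (φ u) := by
      rw [eq_div_iff hcu]
      linarith [key u hu]
    rw [hq'] at e2
    field_simp at e2
    linear_combination e2 + 3 * mu * p u * hsc
  obtain ⟨u, hu⟩ := nonempty_Ioo.2 hab
  have e := HasDerivAt.eq_of_eqOn_Ioo hu hps
    (((dp u hu).mul (((dφ u).sin.pow 2).const_add 1)).const_mul mu)
    ((dφ u).sin.const_mul (-2))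
  have hsc := sin_sq_add_cos_sq (φ u)
  norm_num at e
  have hf' := hfc u hu
  have hps' := hps u hu
  rw [hf'] at e
  have e' : 1 + sin (φ u) ^ 2 - mu * p u * sin (φ u) * cos (φ u) ^ 2 = cos (φ u) ^ 2 := by
    apply mul_left_cancel₀ (mul_ne_zero hmu (hc u hu))
    linear_combination e
  have e3 : mu * p u * cos (φ u) ^ 2 = 2 * sin (φ u) := by
    apply mul_left_cancel₀ (hs u hu)
    linear_combination -e' - hsc
  have e4 : (mu * p u) * 2 = 0 := by
    linear_combination e3 + hps' - mu * p u * hsc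
  exact mul_ne_zero (mul_ne_zero hmu (hp0 u hu).ne') two_ne_zero e4
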